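/- arXiv:2106.01855 — 2 statements merged into one kernel-verified Lean document; each statement's English description precedes it below -/
import Mathlib

section
/- Let R be a commutative ring, A an associative R-algebra, and α : A → A an R-linear anti-endomorphism (α(xy) = α(y)α(x) for all x, y ∈ A). Define a ⋆ b := α(a · b). Then for all a, b, c ∈ A one has α(a) ⋆ (b ⋆ c) = α(α(a) · α(c) · α(b)) and (a ⋆ b) ⋆ α(c) = α(α(b) · α(a) · α(c)); in particular, when α is an anti-involution (α ∘ α = id), the Hom-associativity law α(a) ⋆ (b ⋆ c) = (a ⋆ b) ⋆ α(c) holds for all a, b, c if and only if b·c·a = c·a·b for all a, b, c ∈ A. -/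
/-- Yau's twisted product `a ⋆ b := α (a * b)` for a (possibly non-unital) associative
`R`-algebra `A` and an `R`-linear map `α`. -/
def yauStar {R A : Type*} [CommRing R] [NonUnitalRing A] [Module R A]
    [SMulCommClass R A A] [IsScalarTower R A A]
    (α : A →ₗ[R] A) (a b : A) : A := α (a * b)

/-- For an `R`-linear anti-endomorphism `α` of an associative `R`-algebra `A` and the
twisted product `a ⋆ b := α (a · b)`, one has
`α(a) ⋆ (b ⋆ c) = α(α(a)·α(c)·α(b))` and `(a ⋆ b) ⋆ α(c) = α(α(b)·α(a)·α(c))`;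
and when `α` is an anti-involution, the Hom-associativity law
`α(a) ⋆ (b ⋆ c) = (a ⋆ b) ⋆ α(c)` holds for all `a, b, c` iff `b·c·a = c·a·b` for all
`a, b, c`. -/
theorem yauStar_anti_endomorphism
    {R A : Type*} [CommRing R] [NonUnitalRing A] [Module R A]
    [SMulCommClass R A A] [IsScalarTower R A A]
    (α : A →ₗ[R] A) (hanti : ∀ x y : A, α (x * y) = α y * α x) :
    (∀ a b c : A, yauStar α (α a) (yauStar α b c) = α (α a * α c * α b)) ∧
    (∀ a b c : A, yauStar α (yauStar α a b) (α c) = α (α b * α a * α c)) ∧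
    ((∀ x : A, α (α x) = x) →
      ((∀ a b c : A, yauStar α (α a) (yauStar α b c) = yauStar α (yauStar α a b) (α c)) ↔
        (∀ a b c : A, b * c * a = c * a * b))) := by
  have left (a b c : A) : yauStar α (α a) (yauStar α b c) = α (α a * α c * α b) := by
    simp only [yauStar, hanti b c, mul_assoc]
  have right (a b c : A) : yauStar α (yauStar α a b) (α c) = α (α b * α a * α c) := by
    simp only [yauStar, hanti a b]
  refine ⟨left, right, fun hinv => ?_⟩
  simp only [left, right]
  constructor
  · intro h a b c
    have key := congrArg α (h (α c) (α b) (α a))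
    simp only [hinv] at key
    exact key.symm
  · intro h a b c
    rw [h (α c) (α b) (α a)]
end

section
/- Let R be a commutative ring, A an R-module equipped with an R-bilinear product · possessing a two-sided unit e (e·x = x = x·e for all x ∈ A), and α : A → A an R-linear map. Then (A, ·, α) satisfies Hom-associativity of type I₁ (α(x)·(y·z) = (x·y)·α(z) for all x, y, z) if and only if it satisfies Hom-associativity of type II (x·α(y·z) = α(x·y)·z for all x, y, z). -/
/-- For an `R`-module `A` with an `R`-bilinear product possessing a two-sided unit `e` and
an `R`-linear map `α`, Hom-associativity of type I₁ (`α(x)·(y·z) = (x·y)·α(z)`) holds iff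
Hom-associativity of type II (`x·α(y·z) = α(x·y)·z`) holds. -/
theorem typeI_iff_typeII_of_unital
    {R A : Type*} [CommRing R] [AddCommGroup A] [Module R A]
    (mul : A →ₗ[R] A →ₗ[R] A) (α : A →ₗ[R] A)
    (e : A) (he : ∀ x : A, mul e x = x ∧ mul x e = x) :
    (∀ x y z : A, mul (α x) (mul y z) = mul (mul x y) (α z)) ↔
      (∀ x y z : A, mul x (α (mul y z)) = mul (α (mul x y)) z) := by
  constructor
  · intro h
    have balanced : ∀ x z : A, mul (α x) z = mul x (α z) := fun x z => by
      simpa only [(he z).1, (he x).2] using h x e z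
    intro x y z
    rw [← balanced, balanced (mul x y)]
    exact h x y z
  · intro h
    have balanced : ∀ x z : A, mul x (α z) = mul (α x) z := fun x z => by
      simpa only [(he z).1, (he x).2] using h x e z
    intro x y z
    rw [← balanced, balanced (mul x y)]
    exact h x y z
end
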